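/- arXiv:2508.19901 — 3 statements merged into one kernel-verified Lean document; each statement's English description precedes it below -/
import Mathlib

section
/- Let n ≥ 2 and let H be the binary linear Hamming code of length 2^n − 1, namely H = {c : (F_2^n ∖ {0}) → F_2 | Σ_{v ∈ F_2^n ∖ {0}} c(v)·v = 0}. If there exists a Preparata-like code P ⊆ H (i.e. |P| = 2^(2^n − 2n) and any two distinct elements of P have Hamming distance at least 5), then there exists a line-parallelism of PG(n−1, 2): the set of all lines of PG(n−1,2) can be partitioned into classes, each of which is a spread. -/
/-- Codewords of length `2^n - 1`: functions from nonzero vectors of `F_2^n` to `F_2`. -/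
abbrev Codeword (n : ℕ) := {v : Fin n → ZMod 2 // v ≠ 0} → ZMod 2

/-- The binary linear Hamming code of length `2^n - 1`. -/
def HammingCode (n : ℕ) : Set (Codeword n) :=
  {c | ∑ v : {v : Fin n → ZMod 2 // v ≠ 0}, c v • (v : Fin n → ZMod 2) = 0}

/-- A line of `PG(n-1, 2)`: the set `{a, b, a+b}` for distinct nonzero vectors `a, b`. -/
def IsLine (n : ℕ) (L : Set (Fin n → ZMod 2)) : Prop :=
  ∃ a b : Fin n → ZMod 2, a ≠ 0 ∧ b ≠ 0 ∧ a ≠ b ∧ L = {a, b, a + b}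

/-- A spread of `PG(n-1, 2)`: a set of lines covering each nonzero vector exactly once. -/
def IsSpread (n : ℕ) (S : Set (Set (Fin n → ZMod 2))) : Prop :=
  (∀ L ∈ S, IsLine n L) ∧
  ∀ v : Fin n → ZMod 2, v ≠ 0 → ∃! L, L ∈ S ∧ v ∈ L

open Classical in
/-- The characteristic word of a set of vectors. -/
noncomputable def indicatorWord {n : ℕ} (L : Set (Fin n → ZMod 2)) : Codeword n :=
  fun w => if (w : Fin n → ZMod 2) ∈ L then 1 else 0

/-- The syndrome map, whose kernel is the Hamming code. -/
def syndrome (n : ℕ) : Codeword n →ₗ[ZMod 2] (Fin n → ZMod 2) where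
  toFun c := ∑ v : {v : Fin n → ZMod 2 // v ≠ 0}, c v • (v : Fin n → ZMod 2)
  map_add' c d := by simp [add_smul, Finset.sum_add_distrib]
  map_smul' r c := by simp [mul_smul, Finset.smul_sum]

theorem mem_hammingCode_iff {n : ℕ} {c : Codeword n} :
    c ∈ HammingCode n ↔ syndrome n c = 0 := Iff.rfl

theorem syndrome_single {n : ℕ} (v : {v : Fin n → ZMod 2 // v ≠ 0}) :
    syndrome n (Pi.single v 1) = v := by
  simp [syndrome, Pi.single_apply]

theorem syndrome_surjective (n : ℕ) : Function.Surjective (syndrome n) := by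
  intro v
  by_cases hv : v = 0
  · exact ⟨0, by simp [hv]⟩
  · exact ⟨Pi.single ⟨v, hv⟩ 1, syndrome_single _⟩

theorem add_mem_hammingCode {n : ℕ} {c d : Codeword n} (hc : c ∈ HammingCode n)
    (hd : d ∈ HammingCode n) : c + d ∈ HammingCode n := by
  rw [mem_hammingCode_iff] at *
  rw [map_add, hc, hd, add_zero]

theorem ncard_hammingCode_mul (n : ℕ) : (HammingCode n).ncard * 2 ^ n = 2 ^ (2 ^ n - 1) := by
  have h := Submodule.card_eq_card_quotient_mul_card (LinearMap.ker (syndrome n))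
  have e := ((syndrome n).quotKerEquivOfSurjective (syndrome_surjective n)).toEquiv
  have hN : Fintype.card {v : Fin n → ZMod 2 // v ≠ 0} = 2 ^ n - 1 := by
    simp [Fintype.card_subtype_compl]
  rw [Nat.card_congr e] at h
  simp only [Nat.card_eq_fintype_card, Fintype.card_fun, ZMod.card, Fintype.card_fin, hN] at h
  rw [h, ← Nat.card_coe_set_eq]
  rfl

theorem IsLine.zero_notMem {n : ℕ} {L : Set (Fin n → ZMod 2)} (hL : IsLine n L) :
    (0 : Fin n → ZMod 2) ∉ L := by
  obtain ⟨a, b, ha, hb, hab, rfl⟩ := hL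
  rintro (h | h | h)
  · exact ha h.symm
  · exact hb h.symm
  · have := eq_neg_of_add_eq_zero_left h.symm
    rw [ZModModule.neg_eq_self] at this
    exact hab this

theorem IsLine.exists_eq_of_mem {n : ℕ} {L : Set (Fin n → ZMod 2)} (hL : IsLine n L)
    {v : Fin n → ZMod 2} (hv : v ∈ L) :
    ∃ a, a ≠ 0 ∧ a ≠ v ∧ L = {v, a, v + a} := by
  have h0 := hL.zero_notMem
  obtain ⟨a, b, ha, hb, hab, rfl⟩ := hL
  have h2 : ∀ x y : Fin n → ZMod 2, x + (x + y) = y := fun x y => by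
    rw [← add_assoc, ZModModule.add_self, zero_add]
  rcases hv with rfl | rfl | rfl
  · exact ⟨b, hb, hab.symm, rfl⟩
  · exact ⟨a, ha, hab, by rw [add_comm v a, Set.insert_comm]⟩
  · refine ⟨a, ha, fun h => hb (by simpa using h.symm), ?_⟩
    rw [add_comm (a + b) a, h2]
    ext x
    simp only [Set.mem_insert_iff, Set.mem_singleton_iff]
    tauto

theorem indicatorWord_mem_hammingCode {n : ℕ} {L : Set (Fin n → ZMod 2)} (hL : IsLine n L) :
    indicatorWord L ∈ HammingCode n := by
  have h0 := hL.zero_notMem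
  obtain ⟨a, b, ha, hb, hab, rfl⟩ := hL
  have hc : a + b ≠ 0 := fun h => h0 (by simp [h])
  have h : indicatorWord {a, b, a + b} =
      (Pi.single ⟨a, ha⟩ 1 + Pi.single ⟨b, hb⟩ 1 + Pi.single ⟨a + b, hc⟩ 1 : Codeword n) := by
    ext1 w
    obtain ⟨w, hw⟩ := w
    simp only [indicatorWord, Pi.add_apply, Pi.single_apply, Set.mem_insert_iff,
      Set.mem_singleton_iff, Subtype.mk.injEq]
    by_cases h1 : w = a
    · subst h1; simp [hab, hb]
    · by_cases h2 : w = b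
      · subst h2; simp [h1, ha]
      · simp [h1, h2]
  rw [h, mem_hammingCode_iff, map_add, map_add, syndrome_single, syndrome_single,
    syndrome_single, ZModModule.add_self]

theorem eq_of_indicatorWord_eq {n : ℕ} {L M : Set (Fin n → ZMod 2)} (hL : IsLine n L)
    (hM : IsLine n M) (h : indicatorWord L = indicatorWord M) : L = M := by
  ext w
  by_cases hw : w = 0
  · subst hw
    exact iff_of_false hL.zero_notMem hM.zero_notMem
  · have := congrFun h ⟨w, hw⟩
    simp only [indicatorWord] at this
    by_cases h1 : w ∈ L <;> by_cases h2 : w ∈ M <;> simp_all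

theorem hammingDist_le_of_forall_mem {n : ℕ} {p q : Codeword n} (s : Finset (Fin n → ZMod 2))
    (h : ∀ w, p w ≠ q w → (w : Fin n → ZMod 2) ∈ s) : hammingDist p q ≤ s.card := by
  refine Finset.card_le_card_of_injOn (fun w => (w : Fin n → ZMod 2)) ?_
    Subtype.val_injective.injOn
  intro w hw
  exact h w (by simpa using hw)

section Separated

variable {n : ℕ} {P : Finset (Codeword n)}

theorem add_indicatorWord_inj (hPdist : ∀ p ∈ P, ∀ q ∈ P, p ≠ q → 5 ≤ hammingDist p q)
    {p q : Codeword n} (hp : p ∈ P) (hq : q ∈ P) {L M : Set (Fin n → ZMod 2)}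
    (hL : IsLine n L) (hM : IsLine n M) {v : Fin n → ZMod 2} (hvL : v ∈ L) (hvM : v ∈ M)
    (h : p + indicatorWord L = q + indicatorWord M) : p = q ∧ L = M := by
  have hpq : p = q := by
    by_contra hne
    have h5 := hPdist p hp q hq hne
    obtain ⟨a, -, -, ha⟩ := hL.exists_eq_of_mem hvL
    obtain ⟨b, -, -, hb⟩ := hM.exists_eq_of_mem hvM
    have h4 := hammingDist_le_of_forall_mem (p := p) (q := q) {a, v + a, b, v + b} (by
      intro w hw
      by_contra hnot
      apply hw
      have := congrFun h w
      simp only [Finset.mem_insert, Finset.mem_singleton, not_or] at hnot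
      simp only [Pi.add_apply, indicatorWord, ha, hb, Set.mem_insert_iff,
        Set.mem_singleton_iff, hnot, or_false] at this
      exact add_right_cancel this)
    have := Finset.card_le_four (a := a) (b := v + a) (c := b) (d := v + b)
    omega
  subst hpq
  exact ⟨rfl, eq_of_indicatorWord_eq hL hM (add_left_cancel h)⟩

theorem add_indicatorWord_notMem (hPdist : ∀ p ∈ P, ∀ q ∈ P, p ≠ q → 5 ≤ hammingDist p q)
    {p : Codeword n} (hp : p ∈ P) {L : Set (Fin n → ZMod 2)} (hL : IsLine n L) :
    p + indicatorWord L ∉ P := by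
  intro hq
  obtain ⟨a, b, ha, -, -, rfl⟩ := hL
  have hne : p ≠ p + indicatorWord {a, b, a + b} := fun h => by
    have := congrFun h ⟨a, ha⟩
    simp [indicatorWord] at this
  have h5 := hPdist p hp _ hq hne
  have h3 := hammingDist_le_of_forall_mem (p := p)
    (q := p + indicatorWord {a, b, a + b}) {a, b, a + b} (by
      intro w hw
      by_contra hnot
      apply hw
      simp only [Finset.mem_insert, Finset.mem_singleton, not_or] at hnot
      simp [indicatorWord, hnot])
  have := Finset.card_le_three (a := a) (b := b) (c := a + b)
  omega

/-- Translating a Preparata-like code by the lines through a fixed point `v` covers the rest of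
the Hamming code: the translates are disjoint and their sizes add up. -/
theorem exists_eq_add_indicatorWord (hn : 2 ≤ n) (hPH : ↑P ⊆ HammingCode n)
    (hPcard : P.card = 2 ^ (2 ^ n - 2 * n))
    (hPdist : ∀ p ∈ P, ∀ q ∈ P, p ≠ q → 5 ≤ hammingDist p q)
    {v : Fin n → ZMod 2} (hv : v ≠ 0) {x : Codeword n} (hx : x ∈ HammingCode n) (hxP : x ∉ P) :
    ∃ p ∈ P, ∃ L, IsLine n L ∧ v ∈ L ∧ x = p + indicatorWord L := by
  classical
  let A : Finset (Fin n → ZMod 2) := {0, v}ᶜ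
  let f : Codeword n × (Fin n → ZMod 2) → Codeword n :=
    fun y => y.1 + indicatorWord {v, y.2, v + y.2}
  have hA : ∀ a ∈ A, a ≠ 0 ∧ a ≠ v := fun a ha => by simpa [A] using ha
  have hline : ∀ a ∈ A, IsLine n {v, a, v + a} := fun a ha =>
    ⟨v, a, hv, (hA a ha).1, (hA a ha).2.symm, rfl⟩
  have hfiber : ∀ y ∈ (P ×ˢ A).image f, (((P ×ˢ A).filter fun z => f z = y).card) ≤ 2 := by
    intro y hy
    obtain ⟨⟨p, a⟩, hpa, rfl⟩ := Finset.mem_image.1 hy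
    rw [Finset.mem_product] at hpa
    refine (Finset.card_le_card (t := {(p, a), (p, v + a)}) ?_).trans Finset.card_le_two
    rintro ⟨q, b⟩ hqb
    rw [Finset.mem_filter, Finset.mem_product] at hqb
    obtain ⟨hqp, hba⟩ := add_indicatorWord_inj hPdist hqb.1.1 hpa.1 (hline b hqb.1.2)
      (hline a hpa.2) (v := v) (by simp) (by simp) hqb.2
    have hb : b ∈ ({v, a, v + a} : Set (Fin n → ZMod 2)) := hba ▸ by simp
    have hbv := (hA b hqb.1.2).2
    simp only [Set.mem_insert_iff, Set.mem_singleton_iff, hbv, false_or] at hb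
    simpa [Prod.ext_iff, show q = p from hqp] using hb
  have hcard := Finset.card_le_mul_card_image (P ×ˢ A) 2 hfiber
  have hAcard : A.card = 2 ^ n - 2 := by
    rw [Finset.card_compl, Finset.card_pair hv.symm]
    simp
  rw [Finset.card_product, hAcard] at hcard
  let H : Finset (Codeword n) := (HammingCode n).toFinset
  have hPH' : P ⊆ H := fun p hp => Set.mem_toFinset.2 (hPH hp)
  have himage : (P ×ˢ A).image f ⊆ H \ P := by
    intro y hy
    obtain ⟨⟨p, a⟩, hpa, rfl⟩ := Finset.mem_image.1 hy
    rw [Finset.mem_product] at hpa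
    exact Finset.mem_sdiff.2 ⟨Set.mem_toFinset.2 (add_mem_hammingCode (hPH hpa.1)
      (indicatorWord_mem_hammingCode (hline a hpa.2))),
      add_indicatorWord_notMem hPdist hpa.1 (hline a hpa.2)⟩
  have hHcard : 2 * H.card = P.card * 2 ^ n := by
    have h := ncard_hammingCode_mul n
    rw [Set.ncard_eq_toFinset_card'] at h
    have h2n : 2 * n ≤ 2 ^ n := by
      have := Nat.lt_two_pow_self (n := n - 1)
      obtain ⟨m, rfl⟩ : ∃ m, n = m + 1 := ⟨n - 1, by omega⟩
      rw [pow_succ]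
      simp only [Nat.add_sub_cancel] at this
      omega
    refine Nat.eq_of_mul_eq_mul_right (pow_pos two_pos n) ?_
    rw [mul_assoc, show H.card * 2 ^ n = 2 ^ (2 ^ n - 1) from h, hPcard, ← pow_succ',
      ← pow_add, ← pow_add]
    congr 1
    omega
  have heq : (P ×ˢ A).image f = H \ P := by
    refine Finset.eq_of_subset_of_card_le himage ?_
    rw [Finset.card_sdiff_of_subset hPH']
    rw [Nat.mul_sub] at hcard
    omega
  have hxf : x ∈ (P ×ˢ A).image f :=
    heq ▸ Finset.mem_sdiff.2 ⟨Set.mem_toFinset.2 hx, hxP⟩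
  obtain ⟨⟨p, a⟩, hpa, rfl⟩ := Finset.mem_image.1 hxf
  rw [Finset.mem_product] at hpa
  exact ⟨p, hpa.1, _, hline a hpa.2, by simp, rfl⟩

end Separated

/-- The lines whose characteristic word translates some word of `P` to `x`. -/
def linesTo {n : ℕ} (P : Finset (Codeword n)) (x : Codeword n) : Set (Set (Fin n → ZMod 2)) :=
  {L | IsLine n L ∧ ∃ p ∈ P, x = p + indicatorWord L}

theorem isSpread_linesTo {n : ℕ} (hn : 2 ≤ n) {P : Finset (Codeword n)}
    (hPH : ↑P ⊆ HammingCode n) (hPcard : P.card = 2 ^ (2 ^ n - 2 * n))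
    (hPdist : ∀ p ∈ P, ∀ q ∈ P, p ≠ q → 5 ≤ hammingDist p q)
    {x : Codeword n} (hx : x ∈ HammingCode n) (hxP : x ∉ P) : IsSpread n (linesTo P x) := by
  refine ⟨fun L hL => hL.1, fun v hv => ?_⟩
  obtain ⟨p, hp, L, hL, hvL, hpL⟩ := exists_eq_add_indicatorWord hn hPH hPcard hPdist hv hx hxP
  refine ⟨L, ⟨⟨hL, p, hp, hpL⟩, hvL⟩, ?_⟩
  rintro M ⟨⟨hM, q, hq, hqM⟩, hvM⟩
  exact (add_indicatorWord_inj hPdist hq hp hM hL hvM hvL (hqM.symm.trans hpL)).2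

theorem stmt_1 (n : ℕ) (hn : 2 ≤ n) (P : Finset (Codeword n))
    (hPH : ↑P ⊆ HammingCode n)
    (hPcard : P.card = 2 ^ (2 ^ n - 2 * n))
    (hPdist : ∀ p ∈ P, ∀ q ∈ P, p ≠ q → 5 ≤ hammingDist p q) :
    ∃ Par : Set (Set (Set (Fin n → ZMod 2))),
      (∀ S ∈ Par, IsSpread n S) ∧
      ∀ L : Set (Fin n → ZMod 2), IsLine n L → ∃! S, S ∈ Par ∧ L ∈ S := by
  have hP : P.Nonempty := Finset.card_pos.1 (hPcard ▸ pow_pos two_pos _)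
  obtain ⟨p₀, hp₀⟩ := hP
  have : NeZero n := ⟨by omega⟩
  obtain ⟨v, hv⟩ := exists_ne (0 : Fin n → ZMod 2)
  have hmem : ∀ {M}, IsLine n M → p₀ + indicatorWord M ∈ HammingCode n := fun hM =>
    add_mem_hammingCode (hPH hp₀) (indicatorWord_mem_hammingCode hM)
  have hswap : ∀ {p c d : Codeword n}, p₀ + c = p + d → p₀ + d = p + c := fun {p c d} h => by
    have h' := congrArg (· + (c + d)) h
    rwa [← add_assoc, add_assoc p₀, ZModModule.add_self, add_zero, add_comm c, ← add_assoc,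
      add_assoc p, ZModModule.add_self, add_zero] at h'
  refine ⟨{S | ∃ L, IsLine n L ∧ v ∈ L ∧ S = linesTo P (p₀ + indicatorWord L)}, ?_, ?_⟩
  · rintro S ⟨L, hL, -, rfl⟩
    exact isSpread_linesTo hn hPH hPcard hPdist (hmem hL)
      (add_indicatorWord_notMem hPdist hp₀ hL)
  · intro M hM
    obtain ⟨p, hp, L, hL, hvL, hpL⟩ := exists_eq_add_indicatorWord hn hPH hPcard hPdist hv
      (hmem hM) (add_indicatorWord_notMem hPdist hp₀ hM)
    refine ⟨_, ⟨⟨L, hL, hvL, rfl⟩, hM, p, hp, hswap hpL⟩, ?_⟩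
    rintro _ ⟨⟨L', hL', hvL', rfl⟩, -, q, hq, hqM⟩
    rw [(add_indicatorWord_inj hPdist hq hp hL' hL hvL' hvL ((hswap hqM).symm.trans hpL)).2]
end

section
/- Let n > 3 and let f, f' be quadratic crooked functions over K = F_{2^n}. Let σ be a bijection of K with σ(0) = 0 and let κ be an F_2-linear bijection of K × F_2 such that σ(c_f(p, q)) = c_{f'}(κ(p), κ(q)) for all p, q ∈ K × F_2. Then κ maps the hyperplane K × {0} onto itself: κ(K × {0}) = K × {0}. -/
/-- A crooked function on `K = F_{2^n}`. -/
def Crooked (n : ℕ) (f : GaloisField 2 n → GaloisField 2 n) : Prop :=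
  f 0 = 0 ∧
  (∀ x y z : GaloisField 2 n, x ≠ y → y ≠ z → x ≠ z →
    f x + f y + f z + f (x + y + z) ≠ 0) ∧
  (∀ a : GaloisField 2 n, a ≠ 0 → ∀ x y z : GaloisField 2 n,
    f x + f y + f z + f (x + a) + f (y + a) + f (z + a) ≠ 0)

/-- The coloring function `c_f` on `(K × F_2) × (K × F_2)`. -/
noncomputable def cf (n : ℕ) (f : GaloisField 2 n → GaloisField 2 n)
    (p q : GaloisField 2 n × ZMod 2) : GaloisField 2 n :=
  f (p.1 + q.1) + f p.1 + f q.1 + f (p.2 • q.1 + q.2 • p.1)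

/-- The symmetric bivariate function `B_f(x,y) = f(x+y) + f(x) + f(y)`. -/
noncomputable def Bf (n : ℕ) (f : GaloisField 2 n → GaloisField 2 n)
    (x y : GaloisField 2 n) : GaloisField 2 n :=
  f (x + y) + f x + f y

/-- `f` is quadratic: `B_f` is additive in each argument. -/
def IsQuadratic (n : ℕ) (f : GaloisField 2 n → GaloisField 2 n) : Prop :=
  (∀ x y z : GaloisField 2 n, Bf n f (x + y) z = Bf n f x z + Bf n f y z) ∧
  (∀ x y z : GaloisField 2 n, Bf n f x (y + z) = Bf n f x y + Bf n f x z)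

/-- `f` is almost perfect nonlinear. -/
def IsAPN (n : ℕ) (f : GaloisField 2 n → GaloisField 2 n) : Prop :=
  ∀ a : GaloisField 2 n, a ≠ 0 → ∀ b : GaloisField 2 n,
    {x : GaloisField 2 n | f (x + a) + f x = b}.ncard = 0 ∨
    {x : GaloisField 2 n | f (x + a) + f x = b}.ncard = 2

/-- The map `c_f(p, ·)` is additive when `p` lies in the hyperplane `K × {0}`. -/
theorem cf_add_right {n : ℕ} {f : GaloisField 2 n → GaloisField 2 n} (hf0 : f 0 = 0)
    (hfq : IsQuadratic n f) (x : GaloisField 2 n) (q r : GaloisField 2 n × ZMod 2) :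
    cf n f (x, 0) (q + r) = cf n f (x, 0) q + cf n f (x, 0) r := by
  obtain ⟨y, s⟩ := q
  obtain ⟨z, t⟩ := r
  have key : ∀ (u : ZMod 2) (w : GaloisField 2 n),
      cf n f (x, 0) (w, u) = Bf n f x w + f (u • x) := by
    intro u w
    simp [cf, Bf]
  have hsm : f ((s + t) • x) = f (s • x) + f (t • x) := by
    have h2 : f x + f x = 0 := CharTwo.add_self_eq_zero _
    have h11 : (1 : ZMod 2) + 1 = 0 := rfl
    have h01 : ∀ u : ZMod 2, u = 0 ∨ u = 1 := by decide
    rcases h01 s with rfl | rfl <;> rcases h01 t with rfl | rfl <;> simp [hf0, h2, h11]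
  rw [Prod.mk_add_mk, key, key, key, hfq.2, hsm]
  abel

/-- If `c_f((x, 0), q) = 0` with `x ≠ 0`, then `q` is a multiple of `(x, 0)`. -/
theorem eq_zero_or_eq_of_cf_eq_zero {n : ℕ} {f : GaloisField 2 n → GaloisField 2 n}
    (hf : Crooked n f) {x : GaloisField 2 n} (hx : x ≠ 0) {q : GaloisField 2 n × ZMod 2}
    (hq : cf n f (x, 0) q = 0) : q = 0 ∨ q = (x, 0) := by
  obtain ⟨y, t⟩ := q
  obtain ⟨hf0, hapn, hcr⟩ := hf
  have h01 : ∀ u : ZMod 2, u = 0 ∨ u = 1 := by decide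
  rcases h01 t with rfl | rfl
  · by_cases hy : y = 0
    · left
      simp [hy]
    by_cases hxy : x = y
    · right
      simp [hxy]
    refine absurd ?_ (hapn 0 x y (Ne.symm hx) hxy (Ne.symm hy))
    have hq' : f (x + y) + f x + f y + f 0 = 0 := by simpa [cf] using hq
    rw [zero_add]
    linear_combination hq'
  · exfalso
    refine hcr x hx y y y ?_
    have hq' : f (x + y) + f x + f y + f x = 0 := by simpa [cf] using hq
    have h1 : f x + f x = 0 := CharTwo.add_self_eq_zero _
    have h2 : f y + f y = 0 := CharTwo.add_self_eq_zero _
    have h3 : f (x + y) + f (x + y) = 0 := CharTwo.add_self_eq_zero _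
    rw [add_comm y x]
    linear_combination hq' - h1 + h2 + h3

/-- The map `c_f((x, 0), ·)` is onto `K` for `x ≠ 0`. -/
theorem cf_surjective {n : ℕ} (hn : n ≠ 0) {f : GaloisField 2 n → GaloisField 2 n}
    (hf : Crooked n f) (hfq : IsQuadratic n f) {x : GaloisField 2 n} (hx : x ≠ 0) :
    Function.Surjective (cf n f (x, 0)) := by
  let L : (GaloisField 2 n × ZMod 2) →ₗ[ZMod 2] GaloisField 2 n :=
    (AddMonoidHom.mk' (cf n f (x, 0)) (cf_add_right hf.1 hfq x)).toZModLinearMap 2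
  have hker : LinearMap.ker L ≤ Submodule.span (ZMod 2) {(x, (0 : ZMod 2))} := by
    intro q hq
    rcases eq_zero_or_eq_of_cf_eq_zero hf hx (show cf n f (x, 0) q = 0 from hq) with rfl | rfl
    · exact Submodule.zero_mem _
    · exact Submodule.mem_span_singleton_self _
  have hkr : Module.finrank (ZMod 2) (LinearMap.ker L) ≤ 1 := by
    rw [← finrank_span_singleton (K := ZMod 2) (v := (x, (0 : ZMod 2))) (by simpa using hx)]
    exact Submodule.finrank_mono hker
  have hK : Module.finrank (ZMod 2) (GaloisField 2 n) = n := GaloisField.finrank 2 hn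
  have hrn := LinearMap.finrank_range_add_finrank_ker L
  rw [Module.finrank_prod, hK, Module.finrank_self] at hrn
  have hle := Submodule.finrank_le (LinearMap.range L)
  have htop : LinearMap.range L = ⊤ := Submodule.eq_top_of_finrank_eq (by omega)
  exact LinearMap.range_eq_top.mp htop

theorem stmt_11 (n : ℕ) (hn : 3 < n)
    (f f' : GaloisField 2 n → GaloisField 2 n)
    (hf : Crooked n f) (hfq : IsQuadratic n f)
    (hf' : Crooked n f') (hf'q : IsQuadratic n f')
    (σ : GaloisField 2 n → GaloisField 2 n)
    (hσ : Function.Bijective σ) (hσ0 : σ 0 = 0)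
    (κ : (GaloisField 2 n × ZMod 2) →ₗ[ZMod 2] (GaloisField 2 n × ZMod 2))
    (hκ : Function.Bijective κ)
    (heq : ∀ p q : GaloisField 2 n × ZMod 2, σ (cf n f p q) = cf n f' (κ p) (κ q)) :
    (fun p => κ p) '' {p : GaloisField 2 n × ZMod 2 | p.2 = 0} =
      {p : GaloisField 2 n × ZMod 2 | p.2 = 0} := by
  have hn0 : n ≠ 0 := by omega
  have zmod2 : ∀ t : ZMod 2, t ≠ 0 → t = 1 := by decide
  obtain ⟨w, hw0, hw1⟩ : ∃ w : GaloisField 2 n, w ≠ 0 ∧ w ≠ 1 := by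
    by_contra! h
    have hcard : Nat.card (GaloisField 2 n) = 2 ^ n := GaloisField.card 2 n hn0
    have huniv : (Set.univ : Set (GaloisField 2 n)) ⊆ {0, 1} := by
      intro w _
      by_cases hw : w = 0
      · simp [hw]
      · simp [h w hw]
    have h2 : Nat.card (GaloisField 2 n) ≤ 2 := by
      rw [← Set.ncard_univ]
      exact (Set.ncard_le_ncard huniv).trans ((Set.ncard_insert_le _ _).trans (by simp))
    have h4 : 2 ^ 3 < 2 ^ n := Nat.pow_lt_pow_right (by norm_num) hn
    omega
  -- Some nonzero point of the hyperplane is mapped into the hyperplane.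
  obtain ⟨x, hx, hκx⟩ : ∃ x : GaloisField 2 n, x ≠ 0 ∧ (κ (x, 0)).2 = 0 := by
    by_contra! h
    have h1 := zmod2 _ (h 1 one_ne_zero)
    have hw := zmod2 _ (h w hw0)
    refine h (w + 1) (fun h0 => hw1 (CharTwo.add_eq_zero.mp h0)) ?_
    have hsplit : ((w + 1, 0) : GaloisField 2 n × ZMod 2) = (w, 0) + (1, 0) := by simp
    rw [hsplit, map_add, Prod.snd_add, hw, h1]
    rfl
  have hσadd : ∀ a b, σ (a + b) = σ a + σ b := by
    intro a b
    obtain ⟨q, rfl⟩ := cf_surjective hn0 hf hfq hx a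
    obtain ⟨r, rfl⟩ := cf_surjective hn0 hf hfq hx b
    have hκx' : κ (x, 0) = ((κ (x, 0)).1, 0) := Prod.ext rfl hκx
    rw [← cf_add_right hf.1 hfq, heq, heq, heq, map_add, hκx', cf_add_right hf'.1 hf'q]
  have hsub : (fun p => κ p) '' {p : GaloisField 2 n × ZMod 2 | p.2 = 0} ⊆
      {p : GaloisField 2 n × ZMod 2 | p.2 = 0} := by
    rintro _ ⟨⟨u, s⟩, rfl : s = 0, rfl⟩
    by_contra hne
    have hv : κ (u, 0) = ((κ (u, 0)).1, 1) := Prod.ext rfl (zmod2 _ hne)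
    generalize (κ (u, 0)).1 = v at hv
    have hadd : ∀ q r, cf n f' (v, 1) (q + r) = cf n f' (v, 1) q + cf n f' (v, 1) r := by
      intro q r
      obtain ⟨q, rfl⟩ := hκ.2 q
      obtain ⟨r, rfl⟩ := hκ.2 r
      rw [← map_add, ← hv, ← heq, ← heq, ← heq, cf_add_right hf.1 hfq, hσadd]
    have key : ∀ y, cf n f' (v, 1) (y, 0) = f' (v + y) + f' v := by
      intro y
      have h2 : f' y + f' y = 0 := CharTwo.add_self_eq_zero _
      simp only [cf, one_smul, zero_smul, add_zero]
      linear_combination h2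
    have h := hadd (w, 0) (1, 0)
    rw [Prod.mk_add_mk, add_zero, key, key, key] at h
    refine hf'.2.1 v (v + w) (v + 1) (by simpa using hw0) (by simpa using hw1) (by simp) ?_
    have hsum : v + (v + w) + (v + 1) = v + (w + 1) := by
      have h2 : v + v = 0 := CharTwo.add_self_eq_zero _
      linear_combination h2
    have hd : ∀ a : GaloisField 2 n, a + a = 0 := CharTwo.add_self_eq_zero
    rw [hsum]
    linear_combination h + hd (f' (v + w)) + hd (f' (v + 1)) + hd (f' v)
  refine Set.eq_of_subset_of_ncard_le hsub ?_ (Set.toFinite _)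
  rw [Set.ncard_image_of_injective _ hκ.1]
end

section
/- Let n > 3 and let f, f' be quadratic crooked functions over K = F_{2^n}. Let σ be a bijection of K with σ(0) = 0 and let κ be an F_2-linear bijection of K × F_2 such that σ(c_f(p, q)) = c_{f'}(κ(p), κ(q)) for all p, q ∈ K × F_2. Then σ is F_2-linear, i.e. σ(u + v) = σ(u) + σ(v) for all u, v ∈ K. -/
/-- For a second argument in the hyperplane `K × {0}`, the coloring function is additive in its
first argument. -/
theorem cf_add_left (n : ℕ) (f : GaloisField 2 n → GaloisField 2 n) (hf0 : f 0 = 0)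
    (hfq : IsQuadratic n f) (x : GaloisField 2 n) (p q : GaloisField 2 n × ZMod 2) :
    cf n f (p + q) (x, 0) = cf n f p (x, 0) + cf n f q (x, 0) := by
  obtain ⟨a, b⟩ := p
  obtain ⟨c, d⟩ := q
  have h := hfq.1 a c x
  simp only [Bf] at h
  have hx : f x + f x = 0 := CharTwo.add_self_eq_zero _
  have key : f ((b + d) • x) = f (b • x) + f (d • x) := by
    have hz : ∀ b : ZMod 2, b = 0 ∨ b = 1 := by decide
    have h11 : (1 + 1 : ZMod 2) = 0 := by decide
    rcases hz b with rfl | rfl <;> rcases hz d with rfl | rfl <;> simp [hf0, h11, hx]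
  simp only [cf, Prod.mk_add_mk, zero_smul, add_zero, key, h]
  ring

/-- A quadratic crooked function satisfies `f x ∉ B_f(K, x)` for `x ≠ 0`. -/
theorem Crooked.Bf_ne_apply {n : ℕ} {f : GaloisField 2 n → GaloisField 2 n} (hf : Crooked n f)
    {x : GaloisField 2 n} (hx : x ≠ 0) (a : GaloisField 2 n) : Bf n f a x ≠ f x := by
  intro h
  apply hf.2.2 x hx a 0 0
  have h0 : f (a + x) + f a = 0 := by simpa [Bf] using h
  have hxx : f x + f x = 0 := CharTwo.add_self_eq_zero _
  simp only [hf.1, zero_add, add_zero]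
  linear_combination h0 + hxx

/-- `B_f(a, x)` vanishes for `x ≠ 0` only when `a = 0` or `a = x`. -/
theorem Crooked.eq_zero_or_eq_of_Bf_eq_zero {n : ℕ} {f : GaloisField 2 n → GaloisField 2 n}
    (hf : Crooked n f) {x : GaloisField 2 n} (hx : x ≠ 0) {a : GaloisField 2 n}
    (h : Bf n f a x = 0) : a = 0 ∨ a = x := by
  by_contra! hne
  apply hf.2.1 a x 0 hne.2 hx hne.1
  simp only [hf.1, add_zero]
  rw [← h, Bf]
  ring

/-- For `x ≠ 0`, every color occurs on a pair containing the point `(x, 0)`. -/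
theorem cf_left_surjective {n : ℕ} (hn : n ≠ 0) {f : GaloisField 2 n → GaloisField 2 n}
    (hf : Crooked n f) (hfq : IsQuadratic n f) {x : GaloisField 2 n} (hx : x ≠ 0) :
    Function.Surjective fun p => cf n f p (x, 0) := by
  let φ : (GaloisField 2 n × ZMod 2) →ₗ[ZMod 2] GaloisField 2 n :=
    (AddMonoidHom.mk' (fun p => cf n f p (x, 0)) (cf_add_left n f hf.1 hfq x)).toZModLinearMap 2
  have hφ : ∀ p, φ p = cf n f p (x, 0) := fun _ => rfl
  have hker : LinearMap.ker φ ≤ Submodule.span (ZMod 2) {((x, 0) : GaloisField 2 n × ZMod 2)} := by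
    rintro ⟨a, b⟩ hp
    rw [LinearMap.mem_ker, hφ] at hp
    have hz : ∀ b : ZMod 2, b = 0 ∨ b = 1 := by decide
    rcases hz b with rfl | rfl
    · have hB : Bf n f a x = 0 := by simpa [cf, Bf, hf.1] using hp
      rcases hf.eq_zero_or_eq_of_Bf_eq_zero hx hB with rfl | rfl
      · exact Submodule.zero_mem _
      · exact Submodule.mem_span_singleton_self _
    · refine absurd ?_ (hf.Bf_ne_apply hx a)
      simp only [cf, one_smul, zero_smul, add_zero] at hp
      exact CharTwo.add_eq_zero.mp hp
  have hdim := LinearMap.finrank_range_add_finrank_ker φ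
  have hK : Module.finrank (ZMod 2) (GaloisField 2 n) = n := GaloisField.finrank 2 hn
  rw [Module.finrank_prod, hK, Module.finrank_self] at hdim
  have hker1 := (Submodule.finrank_mono hker).trans (finrank_span_le_card _)
  rw [Set.toFinset_singleton, Finset.card_singleton] at hker1
  have hle := Submodule.finrank_le (LinearMap.range φ)
  have htop : LinearMap.range φ = ⊤ :=
    Submodule.eq_top_of_finrank_eq (by omega)
  exact LinearMap.range_eq_top.mp htop

theorem stmt_13 (n : ℕ) (hn : 3 < n)
    (f f' : GaloisField 2 n → GaloisField 2 n)
    (hf : Crooked n f) (hfq : IsQuadratic n f)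
    (hf' : Crooked n f') (hf'q : IsQuadratic n f')
    (σ : GaloisField 2 n → GaloisField 2 n)
    (hσ : Function.Bijective σ) (hσ0 : σ 0 = 0)
    (κ : (GaloisField 2 n × ZMod 2) →ₗ[ZMod 2] (GaloisField 2 n × ZMod 2))
    (hκ : Function.Bijective κ)
    (heq : ∀ p q : GaloisField 2 n × ZMod 2, σ (cf n f p q) = cf n f' (κ p) (κ q)) :
    ∀ u v : GaloisField 2 n, σ (u + v) = σ u + σ v := by
  have hn0 : n ≠ 0 := by omega
  obtain ⟨⟨x, i⟩, hpker, hp0⟩ : ∃ p ∈ LinearMap.ker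
      ((LinearMap.snd (ZMod 2) (GaloisField 2 n) (ZMod 2)).prod
        (LinearMap.snd (ZMod 2) (GaloisField 2 n) (ZMod 2) ∘ₗ κ)), p ≠ 0 := by
    refine Submodule.exists_mem_ne_zero_of_ne_bot (LinearMap.ker_ne_bot_of_finrank_lt ?_)
    have hK : Module.finrank (ZMod 2) (GaloisField 2 n) = n := GaloisField.finrank 2 hn0
    rw [Module.finrank_prod, Module.finrank_prod, hK, Module.finrank_self]
    omega
  obtain ⟨hi, hκi⟩ : i = 0 ∧ (κ (x, i)).2 = 0 := by simpa using hpker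
  subst hi
  have hx : x ≠ 0 := fun h => hp0 (by simp [h])
  have hκx : κ (x, 0) = ((κ (x, 0)).1, 0) := Prod.ext rfl hκi
  intro u v
  obtain ⟨p, rfl⟩ := cf_left_surjective hn0 hf hfq hx u
  obtain ⟨q, rfl⟩ := cf_left_surjective hn0 hf hfq hx v
  dsimp only
  rw [← cf_add_left n f hf.1 hfq, heq, heq, heq, map_add, hκx, cf_add_left n f' hf'.1 hf'q]
end
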